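/- Let Σ ∈ ℝ^{k×k}, ρ ∈ ℝ^k, and σ² > 0 be such that both Σ and the block matrix M := [[Σ, ρ], [ρᵀ, σ²]] are symmetric positive definite, and let Δμ ∈ ℝ^k and Δv ∈ ℝ. For λ ∈ [0,1] set Λ(λ) := [[Σ, λρ], [λρᵀ, λ²σ² + (1−λ)²]], u(λ) := (Δμ, λΔv), and g(λ) := u(λ)ᵀ Λ(λ)⁻¹ u(λ). Let B, B' be reals with 0 < B ≤ B' ≤ Φ(√(g(1))). Then there exists λ ∈ [0,1] such that Φ(√(g(λ))) ≥ Φ(√(g(0))) and 1 − min(Φ(√(g(λ))), B') / max(Φ(√(g(λ))), B') ≤ 1 − min(Φ(√(g(0))), B) / max(Φ(√(g(0))), B). -/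

import Mathlib

open MeasureTheory ProbabilityTheory Matrix

/-- The cumulative distribution function of the standard normal distribution. -/
noncomputable def stdNormalCDF (x : ℝ) : ℝ :=
  (ProbabilityTheory.gaussianReal 0 1 (Set.Iic x)).toReal

/-- The `(k+1)×(k+1)` block matrix `M = [[S, ρ], [ρᵀ, σsq]]`: the summed class-conditional
covariance matrix of the acquired features together with the (noiseless) auxiliary
feature `Z`. -/
def blockMat {k : ℕ} (S : Matrix (Fin k) (Fin k) ℝ) (ρ : Fin k → ℝ) (σsq : ℝ) :
    Matrix (Fin k ⊕ Fin 1) (Fin k ⊕ Fin 1) ℝ :=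
  Matrix.fromBlocks S (Matrix.of fun i _ => ρ i) (Matrix.of fun _ j => ρ j)
    (Matrix.of fun _ _ => σsq)

/-- The block matrix `Λ(λ) = [[S, λρ], [λρᵀ, λ²σsq + (1−λ)²]]`: the summed class-conditional
covariance matrix of the acquired features together with the noisy auxiliary feature
`Z_λ = λZ + (1−λ)N`. -/
def noisyMat {k : ℕ} (S : Matrix (Fin k) (Fin k) ℝ) (ρ : Fin k → ℝ) (σsq lam : ℝ) :
    Matrix (Fin k ⊕ Fin 1) (Fin k ⊕ Fin 1) ℝ :=
  Matrix.fromBlocks S (Matrix.of fun i _ => lam * ρ i) (Matrix.of fun _ j => lam * ρ j)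
    (Matrix.of fun _ _ => lam ^ 2 * σsq + (1 - lam) ^ 2)

/-- The vector `u(λ) = (Δμ, λΔv)`: the class-conditional mean difference of the acquired
features together with the noisy auxiliary feature `Z_λ`. -/
def noisyVec {k : ℕ} (Δμ : Fin k → ℝ) (Δv lam : ℝ) : Fin k ⊕ Fin 1 → ℝ :=
  Sum.elim Δμ fun _ => lam * Δv

/-- The quadratic form `g(λ) = u(λ)ᵀ Λ(λ)⁻¹ u(λ)`, whose value determines the best
generalized-linear-model AUC `Φ(√(g(λ)))` attainable with the noisy feature `Z_λ`. -/
noncomputable def noisyQuadForm {k : ℕ} (S : Matrix (Fin k) (Fin k) ℝ) (ρ : Fin k → ℝ)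
    (σsq : ℝ) (Δμ : Fin k → ℝ) (Δv lam : ℝ) : ℝ :=
  noisyVec Δμ Δv lam ⬝ᵥ (noisyMat S ρ σsq lam)⁻¹.mulVec (noisyVec Δμ Δv lam)

theorem continuous_stdNormalCDF : Continuous stdNormalCDF := by
  have hcdf : stdNormalCDF = cdf (gaussianReal 0 1) := by
    funext x
    rw [cdf_eq_real]
    rfl
  have : NullSingletonClass (gaussianReal 0 1) := nullSingletonClass_gaussianReal one_ne_zero
  rw [hcdf, continuous_iff_continuousAt]
  intro x
  rw [(monotone_cdf _).continuousAt_iff_leftLim_eq_rightLim, StieltjesFunction.rightLim_eq]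
  have h : (cdf (gaussianReal 0 1)).measure {x} = 0 := by
    rw [measure_cdf, measure_singleton]
  rw [StieltjesFunction.measure_singleton, ENNReal.ofReal_eq_zero] at h
  exact le_antisymm ((monotone_cdf _).leftLim_le le_rfl) (by linarith)

theorem stdNormalCDF_nonneg (x : ℝ) : 0 ≤ stdNormalCDF x := ENNReal.toReal_nonneg

/-- The determinant of `Λ(λ)` interpolates between those of `M` and `S`. -/
theorem det_noisyMat {k : ℕ} {S : Matrix (Fin k) (Fin k) ℝ} (hS : IsUnit S)
    (ρ : Fin k → ℝ) (σsq lam : ℝ) :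
    (noisyMat S ρ σsq lam).det
      = lam ^ 2 * (blockMat S ρ σsq).det + (1 - lam) ^ 2 * S.det := by
  have := hS.invertible
  rw [noisyMat, blockMat, det_fromBlocks₁₁, det_fromBlocks₁₁]
  have hB : (Matrix.of fun i (_ : Fin 1) => lam * ρ i) = lam • Matrix.of fun i _ => ρ i := rfl
  have hC : (Matrix.of fun (_ : Fin 1) j => lam * ρ j) = lam • Matrix.of fun _ j => ρ j := rfl
  rw [hB, hC, Matrix.smul_mul, Matrix.smul_mul, Matrix.mul_smul, det_fin_one, det_fin_one]
  simp only [Matrix.sub_apply, Matrix.smul_apply, of_apply, smul_eq_mul]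
  ring

theorem continuous_noisyQuadForm {k : ℕ} {S : Matrix (Fin k) (Fin k) ℝ} {ρ : Fin k → ℝ}
    {σsq : ℝ} (hS : S.PosDef) (hM : (blockMat S ρ σsq).PosDef) (Δμ : Fin k → ℝ) (Δv : ℝ) :
    Continuous (noisyQuadForm S ρ σsq Δμ Δv) := by
  have hdet (lam : ℝ) : (noisyMat S ρ σsq lam).det ≠ 0 := by
    rw [det_noisyMat hS.isUnit]
    have h₁ := hM.det_pos
    have h₂ := hS.det_pos
    rcases eq_or_ne lam 0 with rfl | h
    · simpa using h₂.ne'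
    · positivity
  have hmat : Continuous (noisyMat S ρ σsq) := by
    unfold noisyMat
    refine Continuous.matrix_fromBlocks continuous_const ?_ ?_ ?_ <;>
      exact continuous_matrix fun _ _ => by simp only [of_apply]; fun_prop
  have hvec : Continuous (noisyVec Δμ Δv) := by
    refine continuous_pi fun i => ?_
    rcases i with i | i <;> simp only [noisyVec, Sum.elim_inl, Sum.elim_inr] <;> fun_prop
  have hinv : Continuous fun lam => (noisyMat S ρ σsq lam)⁻¹ := by
    simp only [inv_def, Ring.inverse_eq_inv']
    exact (hmat.matrix_det.inv₀ hdet).smul hmat.matrix_adjugate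
  exact hvec.dotProduct (hinv.matrix_mulVec hvec)

/-- **Noisy fairAUC theorem (analytic form).** Here `Φ(√(g(λ)))` is the advantaged
group's best GLM AUC after acquiring the noisy feature `Z_λ`, while `B` and `B'`
(with `0 < B ≤ B' ≤ Φ(√(g(1)))`) are the disadvantaged group's AUCs before and after
acquiring the noiseless feature. There is a noise level `λ ∈ [0,1]` for which the
advantaged group's AUC does not decrease, `Φ(√(g(λ))) ≥ Φ(√(g(0)))`, while the bias
`1 − min/max` of the two groups' AUCs does not increase relative to before acquisition. -/
theorem noisy_fairAUC
    {k : ℕ} (S : Matrix (Fin k) (Fin k) ℝ) (ρ : Fin k → ℝ) (σsq : ℝ) (hσ : 0 < σsq)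
    (hS : S.PosDef) (hM : (blockMat S ρ σsq).PosDef) (Δμ : Fin k → ℝ) (Δv : ℝ)
    (B B' : ℝ) (hB : 0 < B) (hBB' : B ≤ B')
    (hB' : B' ≤ stdNormalCDF (Real.sqrt (noisyQuadForm S ρ σsq Δμ Δv 1))) :
    ∃ lam ∈ Set.Icc (0 : ℝ) 1,
      stdNormalCDF (Real.sqrt (noisyQuadForm S ρ σsq Δμ Δv lam))
          ≥ stdNormalCDF (Real.sqrt (noisyQuadForm S ρ σsq Δμ Δv 0)) ∧
      1 - min (stdNormalCDF (Real.sqrt (noisyQuadForm S ρ σsq Δμ Δv lam))) B'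
            / max (stdNormalCDF (Real.sqrt (noisyQuadForm S ρ σsq Δμ Δv lam))) B'
        ≤ 1 - min (stdNormalCDF (Real.sqrt (noisyQuadForm S ρ σsq Δμ Δv 0))) B
            / max (stdNormalCDF (Real.sqrt (noisyQuadForm S ρ σsq Δμ Δv 0))) B := by
  set F : ℝ → ℝ := fun lam => stdNormalCDF (Real.sqrt (noisyQuadForm S ρ σsq Δμ Δv lam))
  have hcont : Continuous F :=
    continuous_stdNormalCDF.comp (continuous_noisyQuadForm hS hM Δμ Δv).sqrt
  have hF0 : 0 ≤ F 0 := stdNormalCDF_nonneg _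
  have hB'pos : 0 < B' := hB.trans_le hBB'
  change ∃ lam ∈ Set.Icc (0 : ℝ) 1, F lam ≥ F 0 ∧
    1 - min (F lam) B' / max (F lam) B' ≤ 1 - min (F 0) B / max (F 0) B
  rcases le_total B' (F 0) with h | h
  · refine ⟨0, ⟨le_rfl, zero_le_one⟩, le_rfl, ?_⟩
    rw [min_eq_right h, max_eq_left h, min_eq_right (hBB'.trans h), max_eq_left (hBB'.trans h)]
    gcongr
  · obtain ⟨lam, hlam, hlamB⟩ :=
      intermediate_value_Icc zero_le_one hcont.continuousOn ⟨h, hB'⟩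
    refine ⟨lam, hlam, hlamB ▸ h, ?_⟩
    rw [hlamB, min_self, max_self, div_self hB'pos.ne', sub_self, sub_nonneg]
    exact div_le_one_of_le₀ min_le_max (hF0.trans (le_max_left _ _))
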